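/- There exists a constant C > 0 such that for every integer n ≥ 2, every integer k with 2 ≤ k ≤ n, every integer s with 2 ≤ s ≤ n, and every δ ∈ (0,1), there is a non-adaptive randomized algorithm making at most C · n · log(n/δ) · log(k/δ) · (n/s + log s) subset queries, each query being a subset of size at most s, which, for every partition of an n-point set U into at most k clusters, outputs exactly that partition with probability at least 1 − δ. -/

import Mathlib

open scoped ENNReal

/-- `count(S)`: the number of clusters (under the cluster labeling `c`) intersecting
the query set `S`. -/
def clusterCount {U K : Type*} [DecidableEq K] (c : U → K) (S : Finset U) : ℕ :=
  (S.image c).card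

open Classical in
/-- The probability of the event `P` under the uniform distribution on a finite type. -/
noncomputable def uniformProb {α : Type*} [Fintype α] (P : α → Prop) : ℝ :=
  (Finset.univ.filter P).card / (Fintype.card α : ℝ)

section UniformProb

variable {α β : Type*} [Fintype α] [Fintype β]

lemma uniformProb_eq (P : α → Prop) [DecidablePred P] :
    uniformProb P = (Finset.univ.filter P).card / (Fintype.card α : ℝ) := by
  unfold uniformProb
  congr!

lemma uniformProb_nonneg (P : α → Prop) : 0 ≤ uniformProb P := by
  unfold uniformProb; positivity

lemma uniformProb_mono {P Q : α → Prop} (h : ∀ a, P a → Q a) :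
    uniformProb P ≤ uniformProb Q := by
  classical
  rw [uniformProb_eq, uniformProb_eq]
  gcongr with a
  exact h a

lemma uniformProb_not [Nonempty α] (P : α → Prop) :
    uniformProb (fun a => ¬ P a) = 1 - uniformProb P := by
  classical
  have h := Finset.card_filter_add_card_filter_not (s := (Finset.univ : Finset α)) P
  have h' : ((Finset.univ.filter P).card : ℝ) + (Finset.univ.filter fun a => ¬ P a).card =
      Fintype.card α := by exact_mod_cast h
  have h0 : (Fintype.card α : ℝ) ≠ 0 := by simp
  rw [uniformProb_eq, uniformProb_eq, eq_sub_iff_add_eq, ← add_div, add_comm, h', div_self h0]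

lemma uniformProb_or_le (P Q : α → Prop) :
    uniformProb (fun a => P a ∨ Q a) ≤ uniformProb P + uniformProb Q := by
  classical
  rw [uniformProb_eq, uniformProb_eq, uniformProb_eq, ← add_div]
  gcongr
  rw [Finset.filter_or]
  exact_mod_cast Finset.card_union_le _ _

lemma uniformProb_exists_le {ι : Type*} [Fintype ι] (P : ι → α → Prop) (b : ℝ)
    (h : ∀ i, uniformProb (P i) ≤ b) :
    uniformProb (fun a => ∃ i, P i a) ≤ Fintype.card ι * b := by
  classical
  calc uniformProb (fun a => ∃ i, P i a) ≤ ∑ i, uniformProb (P i) := by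
        simp only [uniformProb_eq]
        rw [← Finset.sum_div]
        gcongr
        have : (Finset.univ.filter fun a => ∃ i, P i a) =
            Finset.univ.biUnion fun i => Finset.univ.filter (P i) := by
          ext; simp
        rw [this]
        exact_mod_cast Finset.card_biUnion_le
    _ ≤ ∑ _i : ι, b := Finset.sum_le_sum fun i _ => h i
    _ = Fintype.card ι * b := by simp

lemma uniformProb_equiv (e : α ≃ β) (P : β → Prop) :
    uniformProb (fun a => P (e a)) = uniformProb P := by
  classical
  rw [uniformProb_eq, uniformProb_eq, Fintype.card_congr e]
  congr 2
  refine Finset.card_bij (fun a _ => e a) ?_ ?_ ?_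
  · simp
  · simp
  · intro b hb
    exact ⟨e.symm b, by simpa using hb, by simp⟩

lemma uniformProb_fst [Nonempty β] (P : α → Prop) :
    uniformProb (fun x : α × β => P x.1) = uniformProb P := by
  classical
  have h : (Finset.univ.filter fun x : α × β => P x.1) =
      (Finset.univ.filter P) ×ˢ Finset.univ := by
    ext; simp
  have h0 : (Fintype.card β : ℝ) ≠ 0 := by simp
  rw [uniformProb_eq, uniformProb_eq, h, Finset.card_product, Fintype.card_prod, Finset.card_univ]
  push_cast
  rw [mul_div_mul_right _ _ h0]

lemma uniformProb_snd [Nonempty α] (P : β → Prop) :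
    uniformProb (fun x : α × β => P x.2) = uniformProb P := by
  rw [← uniformProb_fst (β := α) P]
  exact uniformProb_equiv (Equiv.prodComm α β) fun x => P x.1

lemma uniformProb_apply {ι : Type*} [Fintype ι] [DecidableEq ι] {γ : ι → Type*}
    [∀ i, Fintype (γ i)] [∀ i, Nonempty (γ i)] (j : ι) (P : γ j → Prop) :
    uniformProb (fun f : ∀ i, γ i => P (f j)) = uniformProb P := by
  rw [← uniformProb_fst (β := ∀ i : {i // i ≠ j}, γ i) P]
  exact uniformProb_equiv (Equiv.piSplitAt j γ) fun x => P x.1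

lemma uniformProb_forall (t : ℕ) (P : α → Prop) :
    uniformProb (fun f : Fin t → α => ∀ i, P (f i)) = uniformProb P ^ t := by
  classical
  have h : (Finset.univ.filter fun f : Fin t → α => ∀ i, P (f i)) =
      Fintype.piFinset fun _ => Finset.univ.filter P := by
    ext; simp
  rw [uniformProb_eq, uniformProb_eq, h, Fintype.card_piFinset_const, Fintype.card_fun,
    Fintype.card_fin, div_pow]
  push_cast
  rfl

lemma one_sub_le_uniformProb [Nonempty α] {P : α → Prop} {d : ℝ}
    (h : uniformProb (fun a => ¬ P a) ≤ d) : 1 - d ≤ uniformProb P := by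
  rw [uniformProb_not] at h
  linarith

lemma uniformProb_forall_le {P : α → Prop} {p : ℝ} (t : ℕ) {L : ℝ}
    (hP : uniformProb P ≤ 1 - p) (hL : L ≤ t * p) :
    uniformProb (fun f : Fin t → α => ∀ i, P (f i)) ≤ Real.exp (-L) := by
  rw [uniformProb_forall]
  calc uniformProb P ^ t ≤ Real.exp (-p) ^ t := by
        gcongr
        · exact uniformProb_nonneg P
        · linarith [Real.add_one_le_exp (-p)]
    _ = Real.exp (t * -p) := (Real.exp_nat_mul _ _).symm
    _ ≤ Real.exp (-L) := Real.exp_le_exp.2 (by linarith)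

end UniformProb

lemma mul_pow_le_add_pow_sub_pow {b h : ℝ} (hb : 0 ≤ b) (hh : 0 ≤ h) (q : ℕ) :
    (q + 1) * b ^ q * h ≤ (b + h) ^ (q + 1) - b ^ (q + 1) := by
  induction q with
  | zero => simp
  | succ q ih =>
    have h1 : b ^ (q + 1) ≤ (b + h) ^ (q + 1) := by gcongr; linarith
    rw [pow_succ (b + h) (q + 1), pow_succ b (q + 1)]
    have h2 := mul_le_mul_of_nonneg_right ih hb
    have h3 := mul_le_mul_of_nonneg_right h1 hh
    push_cast
    have h4 : (q + 1) * b ^ q * h * b = (q + 1) * b ^ (q + 1) * h := by ring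
    nlinarith

/-- A sample of `q` uniform points contains `y` and avoids the cluster of `x`
with probability at least `q / (2n)`, provided `q - 1` times the cluster size is small. -/
lemma le_uniformProb_separates {n k q a : ℕ} (c : Fin n → Fin k) {x y : Fin n}
    (hxy : c y ≠ c x) (ha : (Finset.univ.filter fun z => c z = c x).card = a)
    (hq0 : 0 < q) (hq : 2 * ((q - 1) * (a + 1)) ≤ n) :
    (q : ℝ) / (2 * n) ≤ uniformProb (fun f : Fin q → Fin n =>
      (∃ i, f i = y) ∧ ∀ i, c (f i) ≠ c x) := by
  classical
  obtain ⟨q, rfl⟩ : ∃ p, q = p + 1 := ⟨q - 1, by omega⟩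
  rw [Nat.add_sub_cancel] at hq
  have hn : (0 : ℝ) < n := by exact_mod_cast x.pos
  have : Nonempty (Fin n) := ⟨x⟩
  have hA : uniformProb (fun z : Fin n => c z ≠ c x) = 1 - a / n := by
    rw [uniformProb_not, uniformProb_eq, Fintype.card_fin, ha]
  have hB : uniformProb (fun z : Fin n => ¬ (c z = c x ∨ z = y)) = 1 - (a + 1) / n := by
    rw [uniformProb_not, uniformProb_eq, Fintype.card_fin]
    have : (Finset.univ.filter fun z => c z = c x ∨ z = y) =
        insert y (Finset.univ.filter fun z => c z = c x) := by
      ext z; simp [or_comm]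
    rw [this, Finset.card_insert_of_notMem (by simpa using hxy), ha, Nat.cast_succ]
  have hsplit := uniformProb_or_le
    (fun f : Fin (q + 1) → Fin n => (∃ i, f i = y) ∧ ∀ i, c (f i) ≠ c x)
    (fun f : Fin (q + 1) → Fin n => ∀ i, ¬ (c (f i) = c x ∨ f i = y))
  have hle : uniformProb (fun f : Fin (q + 1) → Fin n => ∀ i, c (f i) ≠ c x) ≤ _ :=
    (uniformProb_mono fun f hf => by
      by_cases h : ∃ i, f i = y
      · exact Or.inl ⟨h, hf⟩
      · exact Or.inr fun i hi => hi.elim (hf i) fun h' => h ⟨i, h'⟩).trans hsplit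
  rw [uniformProb_forall (q + 1) fun z => c z ≠ c x,
    uniformProb_forall (q + 1) fun z => ¬ (c z = c x ∨ z = y), hA, hB] at hle
  have hb : (0 : ℝ) ≤ 1 - (a + 1) / n := hB ▸ uniformProb_nonneg _
  have hpow := mul_pow_le_add_pow_sub_pow hb (h := 1 / n) (by positivity) q
  have hbern := one_add_mul_le_pow (a := -((a + 1 : ℝ) / n)) (by linarith) q
  have hq' : 2 * ((q : ℝ) * (a + 1)) ≤ n := by exact_mod_cast hq
  have hhalf : (1 / 2 : ℝ) ≤ (1 - (a + 1) / n) ^ q := by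
    refine le_trans ?_ (hbern.trans_eq (by ring))
    have : (q : ℝ) * ((a + 1) / n) ≤ 1 / 2 := by
      rw [← mul_div_assoc, div_le_iff₀ hn]; linarith
    linarith
  have heq : (1 - (a + 1) / n + 1 / n : ℝ) = 1 - a / n := by ring
  rw [heq] at hpow
  have hfin : ((q + 1 : ℕ) : ℝ) / (2 * n) ≤ (q + 1) * (1 - (a + 1) / n) ^ q * (1 / n) := by
    have : ((q + 1 : ℕ) : ℝ) / (2 * n) = (q + 1) * (1 / 2) * (1 / n) := by
      push_cast; field_simp
    rw [this]
    gcongr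
  linarith

/-- A decoder returning a consistent labelling with the fewest clusters. -/
lemma exists_fewest_clusters_decoder {I U K : Type*} [Fintype U] [DecidableEq K]
    (Q : I → Finset U) :
    ∃ g : (I → ℕ) → Setoid U, ∀ c : U → K,
      (∀ c' : U → K, (∀ i, clusterCount c' (Q i) = clusterCount c (Q i)) →
        (Finset.univ.image c').card ≤ (Finset.univ.image c).card →
          Setoid.ker c' = Setoid.ker c) →
      g (fun i => clusterCount c (Q i)) = Setoid.ker c := by
  have key : ∀ ans : I → ℕ, ∃ S : Setoid U, ∀ c : U → K,
      (fun i => clusterCount c (Q i)) = ans →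
      (∀ c' : U → K, (∀ i, clusterCount c' (Q i) = clusterCount c (Q i)) →
        (Finset.univ.image c').card ≤ (Finset.univ.image c).card →
          Setoid.ker c' = Setoid.ker c) → S = Setoid.ker c := by
    intro ans
    by_cases h : ∃ c : U → K, (fun i => clusterCount c (Q i)) = ans
    · obtain ⟨c₀, hc₀, hmin⟩ := exists_minimalFor_of_wellFoundedLT
        (fun c : U → K => (fun i => clusterCount c (Q i)) = ans)
        (fun c => (Finset.univ.image c).card) h
      refine ⟨Setoid.ker c₀, fun c hc huniq => huniq c₀ (fun i => ?_) ?_⟩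
      · exact congrFun (hc₀.trans hc.symm) i
      · exact (le_total _ _).elim id fun h' => hmin hc h'
    · exact ⟨⊥, fun c hc => (h ⟨c, hc⟩).elim⟩
  choose g hg using key
  exact ⟨g, fun c hc => hg _ c rfl hc⟩

/-- The query family: for each scale, every test set, alone and with each anchor added. -/
def anchoredQueries {ι : Type*} {n : ℕ} {q t r : ι → ℕ}
    (ω : (∀ j, Fin (t j) → Fin (q j) → Fin n) × (∀ j, Fin (r j) → Fin n)) :
    (Σ j, Option (Fin (r j)) × Fin (t j)) → Finset (Fin n)
  | ⟨j, none, i⟩ => Finset.univ.image (ω.1 j i)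
  | ⟨j, some l, i⟩ => insert (ω.2 j l) (Finset.univ.image (ω.1 j i))

lemma clusterCount_insert {U K : Type*} [DecidableEq U] [DecidableEq K] (c : U → K) (x : U)
    (S : Finset U) :
    clusterCount c (insert x S) = clusterCount c S + if ∃ z ∈ S, c z = c x then 0 else 1 := by
  unfold clusterCount
  rw [Finset.image_insert]
  split_ifs with h
  · rw [Finset.insert_eq_of_mem (by simpa using h), add_zero]
  · rw [Finset.card_insert_of_notMem (by simpa using h)]

/-- If every cluster of `c` has a representative whose `c'`-cluster stays inside it,
and `c'` has at most as many clusters as `c`, then `c` and `c'` give the same partition. -/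
lemma ker_eq_of_representatives {U K : Type*} [Fintype U] [DecidableEq K] {c c' : U → K}
    (hcard : (Finset.univ.image c').card ≤ (Finset.univ.image c).card)
    (h : ∀ x, ∃ x', c x' = c x ∧ ∀ y, c' y = c' x' → c y = c x) :
    Setoid.ker c' = Setoid.ker c := by
  classical
  have hcl : ∀ v : {v // v ∈ Finset.univ.image c}, ∃ x',
      c x' = v ∧ ∀ y, c' y = c' x' → c y = v := by
    rintro ⟨v, hv⟩
    obtain ⟨x, -, rfl⟩ := Finset.mem_image.1 hv
    exact h x
  choose p hp hp' using hcl
  have hinj : Function.Injective fun v : {v // v ∈ Finset.univ.image c} =>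
      (⟨c' (p v), by simp⟩ : {v // v ∈ Finset.univ.image c'}) := by
    intro v w hvw
    have h1 : c' (p v) = c' (p w) := congrArg Subtype.val hvw
    exact Subtype.ext ((hp v).symm.trans (hp' w _ h1))
  have hbij := hinj.bijective_of_nat_card_le (by
    simpa only [Nat.card_eq_fintype_card, Fintype.card_coe] using hcard)
  have hrep : ∀ x, c' x = c' (p ⟨c x, by simp⟩) := by
    intro x
    obtain ⟨v, hv⟩ := hbij.2 ⟨c' x, by simp⟩
    have h1 : c' (p v) = c' x := congrArg Subtype.val hv
    have h2 : c x = v := hp' v x h1.symm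
    rw [← h1]
    congr 2
    exact Subtype.ext h2.symm
  ext x y
  simp only [Setoid.ker_def]
  constructor
  · intro hxy
    have := hp' ⟨c x, by simp⟩ y (by rw [← hxy]; exact hrep x)
    exact this.symm
  · intro hxy
    rw [hrep x, hrep y]
    congr 2
    exact Subtype.ext hxy

/-- Every cluster contains an anchor that the tests separate from all other clusters. -/
def AnchorsSeparate {ι : Type*} {n k : ℕ} {q t r : ι → ℕ} (c : Fin n → Fin k)
    (ω : (∀ j, Fin (t j) → Fin (q j) → Fin n) × (∀ j, Fin (r j) → Fin n)) : Prop :=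
  ∀ x, ∃ j, (∃ l, c (ω.2 j l) = c x) ∧
    ∀ y, c y ≠ c x → ∃ i, (∃ u, ω.1 j i u = y) ∧ ∀ u, c (ω.1 j i u) ≠ c x

lemma AnchorsSeparate.ker_eq {ι : Type*} {n k : ℕ} {q t r : ι → ℕ} {c : Fin n → Fin k}
    {ω : (∀ j, Fin (t j) → Fin (q j) → Fin n) × (∀ j, Fin (r j) → Fin n)}
    (hω : AnchorsSeparate c ω) {c' : Fin n → Fin k}
    (hc' : ∀ i, clusterCount c' (anchoredQueries ω i) = clusterCount c (anchoredQueries ω i))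
    (hcard : (Finset.univ.image c').card ≤ (Finset.univ.image c).card) :
    Setoid.ker c' = Setoid.ker c := by
  refine ker_eq_of_representatives hcard fun x => ?_
  obtain ⟨j, ⟨l, hl⟩, hsep⟩ := hω x
  refine ⟨ω.2 j l, hl, fun y hy => ?_⟩
  by_contra hne
  obtain ⟨i, ⟨u, hu⟩, hi⟩ := hsep y hne
  have h1 := hc' ⟨j, none, i⟩
  have h2 := hc' ⟨j, some l, i⟩
  simp only [anchoredQueries] at h1 h2
  rw [clusterCount_insert, clusterCount_insert, h1, if_pos ⟨y, by simp [← hu], hy⟩,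
    if_neg (by simpa [hl] using hi)] at h2
  omega

lemma le_uniformProb_anchorsSeparate {ι : Type*} [Fintype ι] [DecidableEq ι] {n k : ℕ}
    [Nonempty (Fin n)] {q t r : ι → ℕ} (c : Fin n → Fin k) (φ : Fin k → ι) {δ L₁ L₂ : ℝ}
    {p₁ p₂ : ι → ℝ}
    (htest : ∀ x y, c y ≠ c x → p₁ (φ (c x)) ≤
      uniformProb (fun f : Fin (q (φ (c x))) → Fin n => (∃ i, f i = y) ∧ ∀ i, c (f i) ≠ c x))
    (hanchor : ∀ x, p₂ (φ (c x)) ≤ uniformProb (fun z => c z = c x))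
    (ht : ∀ j, L₁ ≤ t j * p₁ j) (hr : ∀ j, L₂ ≤ r j * p₂ j)
    (hδ : (n * n : ℝ) * Real.exp (-L₁) + k * Real.exp (-L₂) ≤ δ) :
    1 - δ ≤ uniformProb (fun ω : (∀ j, Fin (t j) → Fin (q j) → Fin n) ×
      (∀ j, Fin (r j) → Fin n) => AnchorsSeparate c ω) := by
  apply one_sub_le_uniformProb
  have h1 : ∀ xy : Fin n × Fin n, uniformProb (fun ω : (∀ j, Fin (t j) → Fin (q j) → Fin n) ×
      (∀ j, Fin (r j) → Fin n) => c xy.2 ≠ c xy.1 ∧ ∀ i : Fin (t (φ (c xy.1))),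
        ¬ ((∃ u, ω.1 (φ (c xy.1)) i u = xy.2) ∧ ∀ u, c (ω.1 (φ (c xy.1)) i u) ≠ c xy.1)) ≤
      Real.exp (-L₁) := by
    rintro ⟨x, y⟩
    by_cases hxy : c y = c x
    · simp only [hxy, ne_eq, not_true_eq_false, false_and]
      simpa [uniformProb] using (Real.exp_pos _).le
    · refine (uniformProb_mono fun ω hω => hω.2).trans ?_
      rw [uniformProb_fst (fun ω₁ : ∀ j, Fin (t j) → Fin (q j) → Fin n =>
        ∀ i : Fin (t (φ (c x))),
          ¬ ((∃ u, ω₁ (φ (c x)) i u = y) ∧ ∀ u, c (ω₁ (φ (c x)) i u) ≠ c x)),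
        uniformProb_apply (γ := fun j => Fin (t j) → Fin (q j) → Fin n) (φ (c x))
          (fun F => ∀ i, ¬ ((∃ u, F i u = y) ∧ ∀ u, c (F i u) ≠ c x))]
      refine uniformProb_forall_le (P := fun f : Fin (q (φ (c x))) → Fin n =>
        ¬ ((∃ i, f i = y) ∧ ∀ i, c (f i) ≠ c x)) _ ?_ (ht (φ (c x)))
      rw [uniformProb_not]
      linarith [htest x y hxy]
  have h2 : ∀ v : Fin k, uniformProb (fun ω : (∀ j, Fin (t j) → Fin (q j) → Fin n) ×
      (∀ j, Fin (r j) → Fin n) => (∃ x, c x = v) ∧ ∀ l, c (ω.2 (φ v) l) ≠ v) ≤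
      Real.exp (-L₂) := by
    intro v
    by_cases hv : ∃ x, c x = v
    · obtain ⟨x, rfl⟩ := hv
      refine (uniformProb_mono fun ω hω => hω.2).trans ?_
      rw [uniformProb_snd (fun ω₂ : ∀ j, Fin (r j) → Fin n => ∀ l, c (ω₂ (φ (c x)) l) ≠ c x),
        uniformProb_apply (γ := fun j => Fin (r j) → Fin n) (φ (c x))
          (fun F => ∀ l, c (F l) ≠ c x)]
      refine uniformProb_forall_le (P := fun z => c z ≠ c x) _ ?_ (hr (φ (c x)))
      rw [uniformProb_not]
      linarith [hanchor x]
    · simp only [hv, false_and]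
      simpa [uniformProb] using (Real.exp_pos _).le
  have h3 := uniformProb_exists_le _ _ h1
  have h4 := uniformProb_exists_le _ _ h2
  simp only [Fintype.card_prod, Fintype.card_fin, Nat.cast_mul] at h3 h4
  refine (uniformProb_mono fun ω hω => ?_).trans
    ((uniformProb_or_le _ _).trans ((add_le_add h3 h4).trans hδ))
  by_contra hcon
  push Not at hcon
  refine hω fun x => ⟨φ (c x), ?_, fun y hy => ?_⟩
  · exact hcon.2 (c x) ⟨x, rfl⟩
  · obtain ⟨i, hi⟩ := hcon.1 (x, y) hy
    exact ⟨i, hi⟩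

lemma card_anchoredQueries_le {ι : Type*} {n s : ℕ} {q t r : ι → ℕ} (hq : ∀ j, q j + 1 ≤ s)
    (ω : (∀ j, Fin (t j) → Fin (q j) → Fin n) × (∀ j, Fin (r j) → Fin n))
    (i : Σ j, Option (Fin (r j)) × Fin (t j)) : (anchoredQueries ω i).card ≤ s := by
  obtain ⟨j, l, i⟩ := i
  have h : (Finset.univ.image (ω.1 j i)).card ≤ q j :=
    Finset.card_image_le.trans_eq (by simp)
  cases l with
  | none => exact h.trans ((Nat.le_succ _).trans (hq j))
  | some l => exact (Finset.card_insert_le _ _).trans ((Nat.succ_le_succ h).trans (hq j))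

lemma exists_scale {n a J : ℕ} (ha : 0 < a) :
    ∃ j ≤ J, 2 * ((2 ^ j - 1) * (a + 1)) ≤ n ∧ (j < J → n ≤ a * (8 * 2 ^ j)) := by
  induction J with
  | zero => exact ⟨0, le_rfl, by simp, by simp⟩
  | succ J ih =>
    obtain ⟨j, hj, h1, h2⟩ := ih
    rcases hj.lt_or_eq with hlt | rfl
    · exact ⟨j, by omega, h1, fun _ => h2 hlt⟩
    · by_cases h : 2 * ((2 ^ (j + 1) - 1) * (a + 1)) ≤ n
      · exact ⟨j + 1, le_rfl, h, by simp⟩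
      · refine ⟨j, by omega, h1, fun _ => ?_⟩
        have h3 : (2 ^ (j + 1) - 1) * (a + 1) ≤ 2 ^ (j + 1) * (2 * a) :=
          Nat.mul_le_mul (Nat.sub_le _ _) (by omega)
        have h4 : 2 ^ (j + 1) * (2 * a) = 4 * (a * 2 ^ j) := by ring
        have h5 : a * (8 * 2 ^ j) = 8 * (a * 2 ^ j) := by ring
        omega

lemma log_two_mul_sq_div_le {n : ℕ} (hn : 2 ≤ n) {δ : ℝ} (h0 : 0 < δ) (h1 : δ < 1) :
    Real.log (2 * (n * n) / δ) ≤ 3 * Real.logb 2 (n / δ) ∧ 1 ≤ Real.logb 2 (n / δ) ∧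
      Real.log (2 * n / δ) ≤ 2 * Real.logb 2 (n / δ) := by
  have hn' : (2 : ℝ) ≤ n := by exact_mod_cast hn
  have h2 : (n : ℝ) ≤ n / δ := by
    rw [le_div_iff₀ h0]; nlinarith
  have hpos : 0 < (n : ℝ) / δ := by linarith
  have hlog : Real.log (n / δ) ≤ Real.logb 2 (n / δ) := by
    rw [Real.logb, le_div_iff₀ (Real.log_pos one_lt_two)]
    have := Real.log_nonneg (show (1 : ℝ) ≤ n / δ by linarith)
    nlinarith [Real.log_two_lt_d9]
  have hsq : Real.log (2 * n / δ) ≤ 2 * Real.log (n / δ) := by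
    rw [mul_div_assoc, Real.log_mul two_ne_zero hpos.ne', two_mul]
    gcongr
    linarith
  refine ⟨?_, ?_, by linarith⟩
  · have : (2 * (n * n) / δ : ℝ) = n * (2 * n / δ) := by ring
    rw [this, Real.log_mul (by positivity) (by positivity)]
    have : Real.log n ≤ Real.log (n / δ) := by gcongr
    linarith
  · rw [Real.le_logb_iff_rpow_le one_lt_two hpos]
    simp; linarith

lemma exists_scale_of_label {n k : ℕ} (J : ℕ) (c : Fin n → Fin k) (v : Fin k) :
    ∃ j : Fin (J + 1), (∃ x, c x = v) →
      2 * ((2 ^ (j : ℕ) - 1) * ((Finset.univ.filter fun z => c z = v).card + 1)) ≤ n ∧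
      ((j : ℕ) < J → n ≤ (Finset.univ.filter fun z => c z = v).card * (8 * 2 ^ (j : ℕ))) := by
  by_cases hv : ∃ x, c x = v
  · obtain ⟨x, hx⟩ := hv
    have hpos : 0 < (Finset.univ.filter fun z => c z = v).card :=
      Finset.card_pos.2 ⟨x, by simpa using hx⟩
    obtain ⟨j, hj, hj'⟩ := exists_scale (n := n) (J := J) hpos
    exact ⟨⟨j, by omega⟩, fun _ => hj'⟩
  · exact ⟨0, fun h => (hv h).elim⟩

lemma exists_pmf_of_anchorsSeparate {ι : Type*} [Fintype ι] [DecidableEq ι] {n k s : ℕ}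
    [Nonempty (Fin n)] {q t r : ι → ℕ} {δ : ℝ} (hq : ∀ j, q j + 1 ≤ s)
    (hgood : ∀ c : Fin n → Fin k,
      1 - δ ≤ uniformProb (fun ω : (∀ j, Fin (t j) → Fin (q j) → Fin n) ×
        (∀ j, Fin (r j) → Fin n) => AnchorsSeparate c ω)) :
    ∃ D : PMF ((Fin (Fintype.card (Σ j, Option (Fin (r j)) × Fin (t j))) → Finset (Fin n)) ×
        ((Fin (Fintype.card (Σ j, Option (Fin (r j)) × Fin (t j))) → ℕ) → Setoid (Fin n))),
      (∀ a ∈ D.support, ∀ i, (a.1 i).card ≤ s) ∧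
      ∀ c : Fin n → Fin k, ENNReal.ofReal (1 - δ) ≤
        D.toOuterMeasure {a | a.2 (fun i => clusterCount c (a.1 i)) = Setoid.ker c} := by
  classical
  let Ω := (∀ j, Fin (t j) → Fin (q j) → Fin n) × (∀ j, Fin (r j) → Fin n)
  let e := (Fintype.equivFin (Σ j, Option (Fin (r j)) × Fin (t j))).symm
  let Q : Ω → Fin (Fintype.card (Σ j, Option (Fin (r j)) × Fin (t j))) → Finset (Fin n) :=
    fun ω i => anchoredQueries ω (e i)
  choose g hg using fun ω : Ω => exists_fewest_clusters_decoder (K := Fin k) (Q ω)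
  refine ⟨(PMF.uniformOfFintype Ω).map fun ω => (Q ω, g ω), ?_, fun c => ?_⟩
  · intro a ha i
    obtain ⟨ω, -, rfl⟩ := (PMF.mem_support_map_iff _ _ _).1 ha
    exact card_anchoredQueries_le hq ω _
  have hsub : {ω : Ω | AnchorsSeparate c ω} ⊆ (fun ω => (Q ω, g ω)) ⁻¹'
      {a | a.2 (fun i => clusterCount c (a.1 i)) = Setoid.ker c} := by
    intro ω hω
    refine hg ω c fun c' hc' hcard => AnchorsSeparate.ker_eq hω (fun i => ?_) hcard
    simpa [Q] using hc' (e.symm i)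
  rw [PMF.toOuterMeasure_map_apply]
  refine le_trans ?_ (MeasureTheory.measure_mono hsub)
  rw [PMF.toOuterMeasure_uniformOfFintype_apply]
  refine (ENNReal.ofReal_le_ofReal (hgood c)).trans_eq ?_
  rw [uniformProb_eq, ENNReal.ofReal_div_of_pos (by exact_mod_cast Fintype.card_pos),
    ENNReal.ofReal_natCast, ENNReal.ofReal_natCast, ← Fintype.card_subtype]
  rfl

/-- `1 / anchorScale n J j` is a lower bound for the relative size of the clusters
handled at scale `j`, where the last scale `J` handles all small clusters. -/
noncomputable def anchorScale (n J j : ℕ) : ℝ := if j < J then 8 * 2 ^ j else n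

lemma one_le_anchorScale {n : ℕ} (hn : 0 < n) (J j : ℕ) : 1 ≤ anchorScale n J j := by
  have h1 : (1 : ℝ) ≤ 2 ^ j := one_le_pow₀ one_le_two
  have h2 : (1 : ℝ) ≤ n := by exact_mod_cast hn
  unfold anchorScale
  split_ifs <;> linarith

lemma sum_anchorScale_div_le {n s J : ℕ} (hJ1 : 2 ^ J ≤ s) (hJ2 : s ≤ 2 ^ (J + 1)) :
    ∑ j ∈ Finset.range (J + 1), anchorScale n J j / 2 ^ j ≤
      8 * ((n : ℝ) / s + Real.logb 2 s) := by
  have hs0 : (0 : ℝ) < s := by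
    exact_mod_cast (Nat.two_pow_pos J).trans_le hJ1
  have h1 : ∑ j ∈ Finset.range J, anchorScale n J j / 2 ^ j = 8 * J := by
    rw [Finset.sum_congr rfl (g := fun _ => (8 : ℝ))]
    · simp [mul_comm]
    · intro j hj
      simp [anchorScale, Finset.mem_range.1 hj]
  have h2 : (J : ℝ) ≤ Real.logb 2 s := by
    rw [Real.le_logb_iff_rpow_le one_lt_two hs0, Real.rpow_natCast]
    exact_mod_cast hJ1
  have h3 : anchorScale n J J / 2 ^ J ≤ 2 * (n / s) := by
    have : (s : ℝ) ≤ 2 * 2 ^ J := by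
      rw [pow_succ'] at hJ2
      exact_mod_cast hJ2
    simp only [anchorScale, lt_irrefl, if_false]
    rw [div_le_iff₀ (by positivity), mul_assoc, div_mul_eq_mul_div, ← mul_div_assoc,
      le_div_iff₀ hs0]
    nlinarith
  have h4 : (0 : ℝ) ≤ n / s := by positivity
  rw [Finset.sum_range_succ]
  linarith

lemma ceil_mul_ceil_le {h x A B L₁ L₂ : ℝ} (hh : 1 ≤ h) (hx : 1 ≤ x) (hA : 1 ≤ A) (hB : 1 ≤ B)
    (hL₁0 : 0 ≤ L₁) (hL₂0 : 0 ≤ L₂) (hL₁ : L₁ ≤ 3 * A) (hL₂ : L₂ ≤ 2 * B) :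
    ((⌈h * L₂⌉₊ : ℝ) + 1) * ⌈2 * x * L₁⌉₊ ≤ 28 * (x * h * A * B) := by
  have ht : (⌈2 * x * L₁⌉₊ : ℝ) ≤ 7 * x * A := by
    have h2 : (⌈2 * x * L₁⌉₊ : ℝ) < 2 * x * L₁ + 1 := Nat.ceil_lt_add_one (by positivity)
    have h3 : 2 * x * L₁ ≤ 2 * x * (3 * A) := by gcongr
    have h5 : 1 ≤ x * A := one_le_mul_of_one_le_of_one_le hx hA
    linarith
  have hr : (⌈h * L₂⌉₊ : ℝ) + 1 ≤ 4 * h * B := by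
    have h2 : (⌈h * L₂⌉₊ : ℝ) < h * L₂ + 1 := Nat.ceil_lt_add_one (by positivity)
    have h3 : h * L₂ ≤ h * (2 * B) := by gcongr
    have h5 : 1 ≤ h * B := one_le_mul_of_one_le_of_one_le hh hB
    linarith
  calc ((⌈h * L₂⌉₊ : ℝ) + 1) * ⌈2 * x * L₁⌉₊ ≤ (4 * h * B) * (7 * x * A) := by gcongr
    _ = _ := by ring

lemma le_uniformProb_anchorsSeparate_scales {n k J : ℕ} [Nonempty (Fin n)] (c : Fin n → Fin k)
    {L₁ L₂ δ : ℝ} {t r : ℕ → ℕ} (ht : ∀ j, 2 * (n / 2 ^ j) * L₁ ≤ t j)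
    (hr : ∀ j, anchorScale n J j * L₂ ≤ r j)
    (hδ : (n * n : ℝ) * Real.exp (-L₁) + k * Real.exp (-L₂) ≤ δ) :
    1 - δ ≤ uniformProb (fun ω : (∀ j : Fin (J + 1), Fin (t j) → Fin (2 ^ (j : ℕ)) → Fin n) ×
      (∀ j : Fin (J + 1), Fin (r j) → Fin n) => AnchorsSeparate c ω) := by
  have hn : 0 < n := Fin.pos_iff_nonempty.2 ‹_›
  have hn0 : (0 : ℝ) < n := by exact_mod_cast hn
  choose φ hφ using exists_scale_of_label J c
  refine le_uniformProb_anchorsSeparate c φ (L₁ := L₁) (L₂ := L₂)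
    (p₁ := fun j => ((2 ^ (j : ℕ) : ℕ) : ℝ) / (2 * n)) (p₂ := fun j => 1 / anchorScale n J j)
    ?_ ?_ ?_ ?_ hδ
  · intro x y hxy
    exact le_uniformProb_separates c hxy rfl (Nat.two_pow_pos _) (hφ (c x) ⟨x, rfl⟩).1
  · intro x
    have h2 := (hφ (c x) ⟨x, rfl⟩).2
    have hpos : 1 ≤ (Finset.univ.filter fun z => c z = c x).card :=
      Finset.card_pos.2 ⟨x, by simp⟩
    have h3 : (n : ℝ) ≤
        (Finset.univ.filter fun z => c z = c x).card * anchorScale n J (φ (c x)) := by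
      by_cases hlt : (φ (c x) : ℕ) < J
      · simp only [anchorScale, hlt, if_true]
        exact_mod_cast h2 hlt
      · simp only [anchorScale, hlt, if_false]
        exact_mod_cast Nat.le_mul_of_pos_left n hpos
    have h5 := one_le_anchorScale hn J (φ (c x))
    rw [uniformProb_eq, Fintype.card_fin, div_le_div_iff₀ (by linarith) hn0]
    linarith
  · intro j
    push_cast
    calc L₁ = 2 * (n / 2 ^ (j : ℕ)) * L₁ * (2 ^ (j : ℕ) / (2 * n)) := by field_simp
      _ ≤ _ := by
        gcongr
        exact ht j
  · intro j
    have h3 := one_le_anchorScale hn J j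
    rw [mul_one_div, le_div_iff₀ (by linarith), mul_comm]
    exact hr j

/-- There is a constant `C > 0` such that for all `n ≥ 2`, `2 ≤ k ≤ n`, `2 ≤ s ≤ n`,
`δ ∈ (0,1)`, there is a non-adaptive randomized algorithm making at most
`C·n·log₂(n/δ)·log₂(k/δ)·(n/s + log₂ s)` subset queries, each query of size at most `s`,
which for every partition of an `n`-point set into at most `k` clusters outputs exactly
that partition with probability at least `1 - δ`. -/
theorem nonadaptive_clustering_bounded_size_group_testing :
    ∃ C : ℝ, 0 < C ∧
      ∀ n k s : ℕ, 2 ≤ n → 2 ≤ k → k ≤ n → 2 ≤ s → s ≤ n →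
        ∀ δ : ℝ, 0 < δ → δ < 1 →
          ∃ m : ℕ,
            (m : ℝ) ≤ C * n * Real.logb 2 (n / δ) * Real.logb 2 (k / δ) *
                ((n : ℝ) / s + Real.logb 2 s) ∧
            ∃ D : PMF ((Fin m → Finset (Fin n)) × ((Fin m → ℕ) → Setoid (Fin n))),
              (∀ a ∈ D.support, ∀ i : Fin m, (a.1 i).card ≤ s) ∧
              ∀ c : Fin n → Fin k,
                ENNReal.ofReal (1 - δ) ≤
                  D.toOuterMeasure
                    {a | a.2 (fun i => clusterCount c (a.1 i)) = Setoid.ker c} := by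
  refine ⟨224, by norm_num, fun n k s hn hk _ hs hsn δ h0 h1 => ?_⟩
  have : Nonempty (Fin n) := ⟨⟨0, by omega⟩⟩
  obtain ⟨hA1, hA, -⟩ := log_two_mul_sq_div_le hn h0 h1
  obtain ⟨-, hB, hB1⟩ := log_two_mul_sq_div_le hk h0 h1
  have hn2 : (2 : ℝ) ≤ n := by exact_mod_cast hn
  have hk2 : (2 : ℝ) ≤ k := by exact_mod_cast hk
  have hL₁0 : 0 ≤ Real.log (2 * (n * n) / δ) := Real.log_nonneg (by
    rw [one_le_div h0]
    nlinarith)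
  have hL₂0 : 0 ≤ Real.log (2 * k / δ) := Real.log_nonneg (by
    rw [one_le_div h0]
    linarith)
  have hδ : (n * n : ℝ) * Real.exp (-Real.log (2 * (n * n) / δ)) +
      k * Real.exp (-Real.log (2 * k / δ)) ≤ δ := by
    rw [Real.exp_neg, Real.exp_neg, Real.exp_log (by positivity), Real.exp_log (by positivity)]
    apply le_of_eq
    field_simp
    ring
  generalize Real.log (2 * (n * n) / δ) = L₁ at *
  generalize Real.log (2 * k / δ) = L₂ at *
  generalize Real.logb 2 (n / δ) = A at *
  generalize Real.logb 2 (k / δ) = B at *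
  obtain ⟨J, hJ1, hJ2⟩ : ∃ J, 2 ^ J ≤ s - 1 ∧ s - 1 < 2 ^ (J + 1) :=
    ⟨Nat.log 2 (s - 1), Nat.pow_log_le_self 2 (by omega),
      Nat.lt_pow_succ_log_self (by norm_num) _⟩
  have hqs : ∀ j ≤ J, 2 ^ j + 1 ≤ s := fun j hj => by
    have := Nat.pow_le_pow_right (show 0 < 2 by norm_num) hj
    omega
  obtain ⟨t, ht⟩ : ∃ t : ℕ → ℕ, ∀ j, t j = ⌈2 * (n / 2 ^ j) * L₁⌉₊ := ⟨_, fun _ => rfl⟩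
  obtain ⟨r, hr⟩ : ∃ r : ℕ → ℕ, ∀ j, r j = ⌈anchorScale n J j * L₂⌉₊ := ⟨_, fun _ => rfl⟩
  refine ⟨_, ?_, exists_pmf_of_anchorsSeparate (n := n) (k := k) (s := s) (δ := δ)
    (q := fun j : Fin (J + 1) => 2 ^ (j : ℕ)) (t := fun j => t j) (r := fun j => r j)
    (fun j => hqs j (Nat.lt_succ_iff.1 j.2)) fun c =>
      le_uniformProb_anchorsSeparate_scales c (fun j => ht j ▸ Nat.le_ceil _)
        (fun j => hr j ▸ Nat.le_ceil _) hδ⟩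
  have hterm : ∀ j ∈ Finset.range (J + 1),
      ((r j : ℝ) + 1) * t j ≤ 28 * n * A * B * (anchorScale n J j / 2 ^ j) := by
    intro j hj
    have hqn : (1 : ℝ) ≤ n / 2 ^ j := by
      rw [one_le_div (by positivity)]
      have := hqs j (Nat.lt_succ_iff.1 (Finset.mem_range.1 hj))
      exact_mod_cast (by omega : 2 ^ j ≤ n)
    rw [hr, ht]
    refine (ceil_mul_ceil_le (one_le_anchorScale (by omega) J j) hqn hA hB hL₁0 hL₂0 hA1
      hB1).trans_eq ?_
    ring
  calc _ = ∑ j ∈ Finset.range (J + 1), ((r j : ℝ) + 1) * t j := by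
        rw [← Fin.sum_univ_eq_sum_range (fun j => ((r j : ℝ) + 1) * t j)]
        simp [Fintype.card_sigma]
    _ ≤ 28 * n * A * B * ∑ j ∈ Finset.range (J + 1), anchorScale n J j / 2 ^ j := by
        rw [Finset.mul_sum]
        exact Finset.sum_le_sum hterm
    _ ≤ 28 * n * A * B * (8 * ((n : ℝ) / s + Real.logb 2 s)) := by
        gcongr
        exact sum_anchorScale_div_le (by omega) (by omega)
    _ = _ := by ring
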